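/- arXiv:1509.01844 — 2 statements merged into one kernel-verified Lean document; each statement's English description precedes it below -/
import Mathlib

section
/- There is a constant C > 0 such that for every ε ∈ (0,1) and every weighted 2SAT formula Φ over n boolean variables (a finite set of clauses, each clause a disjunction of two literals, with nonnegative weights), there exists a reweighted sub-formula Φ_ε consisting of at most C·n/ε² of the clauses of Φ such that for every truth assignment A, the total weight of clauses of Φ_ε satisfied by A lies within the interval [(1−ε)·W(A), (1+ε)·W(A)], where W(A) is the total weight of clauses of Φ satisfied by A. -/
/-- The truth value of a literal: the literal `(v, b)` (the variable `v` if `b = true`,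
its negation if `b = false`) under the assignment `A`. -/
def litVal {V : Type} (A : V → Bool) (l : V × Bool) : Bool := A l.1 == l.2

/-- The value of an assignment `A` on the weighted 2SAT formula with clause set `Φ`
(each clause is a disjunction of two literals) and weights `w`: the total weight of the
satisfied clauses. -/
def twoSatVal {V : Type} (Φ : Finset ((V × Bool) × (V × Bool)))
    (w : (V × Bool) × (V × Bool) → ℝ) (A : V → Bool) : ℝ :=
  ∑ c ∈ Φ, if litVal A c.1 || litVal A c.2 then w c else 0

open Matrix
open scoped ComplexOrder

/-- Spectral description of the shifts of a positive definite matrix. -/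
lemma spec_shift {k : ℕ} {P : Matrix (Fin k) (Fin k) ℂ} (hP : P.PosDef) :
    ∃ p : Fin k → ℝ, (∀ i, 0 < p i) ∧ ∀ δ : ℝ, (∀ i, 0 < p i + δ) →
      (P + (δ : ℂ) • (1 : Matrix (Fin k) (Fin k) ℂ)).PosDef ∧
      ((P + (δ : ℂ) • (1 : Matrix (Fin k) (Fin k) ℂ))⁻¹).trace.re = ∑ i, (p i + δ)⁻¹ ∧
      ((P + (δ : ℂ) • (1 : Matrix (Fin k) (Fin k) ℂ))⁻¹ *
        (P + (δ : ℂ) • (1 : Matrix (Fin k) (Fin k) ℂ))⁻¹).trace.re = ∑ i, ((p i + δ)⁻¹) ^ 2 := by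
  have hH := hP.isHermitian
  refine ⟨hH.eigenvalues, fun i => hP.eigenvalues_pos i, fun δ hδ => ?_⟩
  set U := hH.eigenvectorUnitary
  set φ := Unitary.conjStarAlgAut ℂ (Matrix (Fin k) (Fin k) ℂ) U with hφ
  have htr : ∀ D : Matrix (Fin k) (Fin k) ℂ, (φ D).trace = D.trace := by
    intro D
    rw [hφ, Unitary.conjStarAlgAut_apply, Matrix.trace_mul_comm, ← mul_assoc]
    simp
  have e1 : P + (δ : ℂ) • (1 : Matrix (Fin k) (Fin k) ℂ)
      = φ (diagonal fun i => ((hH.eigenvalues i + δ : ℝ) : ℂ)) := by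
    have h1 : (diagonal fun i => ((hH.eigenvalues i + δ : ℝ) : ℂ))
      = diagonal (RCLike.ofReal ∘ hH.eigenvalues) + (δ : ℂ) • (1 : Matrix (Fin k) (Fin k) ℂ) := by
      ext i j
      by_cases h : i = j
      · subst h; simp
      · simp [h]
    rw [h1, map_add, ← hH.spectral_theorem, map_smul, map_one]
  have e2 : (P + (δ : ℂ) • (1 : Matrix (Fin k) (Fin k) ℂ))⁻¹
      = φ (diagonal fun i => (((hH.eigenvalues i + δ)⁻¹ : ℝ) : ℂ)) := by
    apply Matrix.inv_eq_right_inv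
    rw [e1, ← map_mul, diagonal_mul_diagonal]
    have : (fun i => ((hH.eigenvalues i + δ : ℝ) : ℂ) * (((hH.eigenvalues i + δ)⁻¹ : ℝ) : ℂ))
        = fun _ => 1 := by
      funext i
      rw [← Complex.ofReal_mul, mul_inv_cancel₀ (hδ i).ne']
      simp
    rw [this, diagonal_one, map_one]
  refine ⟨?_, ?_, ?_⟩
  · rw [e1, hφ, Unitary.conjStarAlgAut_apply]
    have hu : IsUnit (U : Matrix (Fin k) (Fin k) ℂ) := ⟨Unitary.toUnits U, rfl⟩
    have := (Matrix.IsUnit.posDef_star_right_conjugate_iff (x := diagonal fun i => ((hH.eigenvalues i + δ : ℝ) : ℂ)) hu)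
    rw [this, posDef_diagonal_iff]
    intro i
    exact_mod_cast hδ i
  · rw [e2, htr, trace_diagonal, Complex.re_sum]
    rfl
  · rw [e2, ← map_mul, htr, diagonal_mul_diagonal, trace_diagonal, Complex.re_sum]
    refine Finset.sum_congr rfl fun i _ => ?_
    rw [← Complex.ofReal_mul, Complex.ofReal_re, sq]

/-- Sherman–Morrison for the trace of the inverse. -/
lemma rank_one_update {k : ℕ} {P : Matrix (Fin k) (Fin k) ℂ} (hP : P.PosDef) (v : Fin k → ℂ)
    (s : ℝ) (hs : 0 < 1 + s * (star v ⬝ᵥ P⁻¹ *ᵥ v).re) :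
    (P + (s : ℂ) • vecMulVec v (star v)).PosDef ∧
    ((P + (s : ℂ) • vecMulVec v (star v))⁻¹).trace.re = (P⁻¹).trace.re -
      s * (star v ⬝ᵥ (P⁻¹ * P⁻¹) *ᵥ v).re / (1 + s * (star v ⬝ᵥ P⁻¹ *ᵥ v).re) := by
  have hB := hP.inv
  set B := P⁻¹ with hBdef
  set q := (star v ⬝ᵥ B *ᵥ v).re with hq
  have hqc : star v ⬝ᵥ B *ᵥ v = (q : ℂ) := by
    have := hB.posSemidef.dotProduct_mulVec_nonneg v
    rw [Complex.le_def] at this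
    apply Complex.ext
    · simp [hq]
    · simpa using this.2.symm
  have hq0 : 0 ≤ q := by
    have := hB.posSemidef.dotProduct_mulVec_nonneg v
    rw [Complex.le_def] at this
    exact this.1
  have hPu := hP.isUnit
  have hPB : P * B = 1 := Matrix.mul_nonsing_inv P ((Matrix.isUnit_iff_isUnit_det P).1 hPu)
  have hBP : B * P = 1 := Matrix.nonsing_inv_mul P ((Matrix.isUnit_iff_isUnit_det P).1 hPu)
  set W := vecMulVec v (star v) with hW
  have hWBW : W * B * W = (q : ℂ) • W := by
    rw [hW, mul_assoc, mul_vecMulVec, vecMulVec_mul_vecMulVec, hqc, vecMulVec_smul]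
  have hWH : W.IsHermitian := by
    rw [IsHermitian, hW, conjTranspose_vecMulVec, star_star]
  have hWx : ∀ x : Fin k → ℂ, star x ⬝ᵥ W *ᵥ x = ((Complex.normSq (star v ⬝ᵥ x) : ℝ) : ℂ) := by
    intro x
    have h1 : star x ⬝ᵥ v = star (star v ⬝ᵥ x) := by
      rw [star_dotProduct]
    rw [hW, vecMulVec_mulVec, dotProduct_smul, h1]
    simp [Complex.normSq_eq_conj_mul_self, mul_comm]
  constructor
  · refine PosDef.of_dotProduct_mulVec_pos ?_ ?_
    · refine hP.isHermitian.add ?_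
      rw [IsHermitian, conjTranspose_smul, hWH.eq]
      simp
    · intro x hx
      have hX := hP.dotProduct_mulVec_pos hx
      rw [Complex.lt_def] at hX ⊢
      rw [add_mulVec, dotProduct_add, smul_mulVec, dotProduct_smul, hWx]
      have hps := hP.posSemidef.conjTranspose_mul_mul_same (1 + (s : ℂ) • (B * W))
      have he : (1 + (s : ℂ) • (B * W))ᴴ * P * (1 + (s : ℂ) • (B * W))
          = P + ((2 * s + s ^ 2 * q : ℝ) : ℂ) • W := by
        have h0 : (1 + (s : ℂ) • (B * W))ᴴ = 1 + (s : ℂ) • (W * B) := by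
          rw [conjTranspose_add, conjTranspose_one, conjTranspose_smul, conjTranspose_mul,
            hWH.eq, hB.isHermitian.eq]
          simp
        have h1 : W * B * P = W := by rw [mul_assoc, hBP, mul_one]
        have h2 : P * (B * W) = W := by rw [← mul_assoc, hPB, one_mul]
        have h3 : W * (B * W) = (q : ℂ) • W := by rw [← mul_assoc, hWBW]
        rw [h0, add_mul, one_mul, smul_mul_assoc, h1, mul_add, mul_one, mul_smul_comm, add_mul, h2,
          smul_mul_assoc, h3]
        push_cast
        module
      rw [he] at hps
      have h4 := hps.dotProduct_mulVec_nonneg x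
      rw [add_mulVec, dotProduct_add, smul_mulVec, dotProduct_smul, hWx, Complex.le_def] at h4
      have h5 := h4.1
      simp only [smul_eq_mul, Complex.add_re, Complex.re_ofReal_mul, Complex.ofReal_re,
        Complex.zero_re, Complex.add_im, Complex.im_ofReal_mul, Complex.ofReal_im, Complex.zero_im,
        mul_zero, add_zero] at h5 hX ⊢
      refine ⟨?_, hX.2⟩
      have hn := Complex.normSq_nonneg (star v ⬝ᵥ x)
      set n := Complex.normSq (star v ⬝ᵥ x)
      rcases le_or_gt 0 s with h | h
      · have := mul_nonneg h hn
        linarith [hX.1]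
      · rcases hn.eq_or_lt with h6 | h6
        · rw [← h6]; simpa using hX.1
        · have := mul_pos (mul_pos (neg_pos.2 h) hs) h6
          nlinarith
  · have hne : (1 + (s : ℂ) * q) ≠ 0 := by
      exact_mod_cast hs.ne'
    have hinv : (P + (s : ℂ) • W)⁻¹ = B - ((s : ℂ) / (1 + s * q)) • (B * W * B) := by
      apply Matrix.inv_eq_right_inv
      have h1 : P * (B * W * B) = W * B := by
        rw [mul_assoc, ← mul_assoc, hPB, one_mul]
      have h2 : W * (B * W * B) = (q : ℂ) • (W * B) := by
        rw [← mul_assoc, ← mul_assoc, hWBW, smul_mul_assoc]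
      rw [add_mul, mul_sub, mul_sub, hPB, mul_smul_comm, h1, smul_mul_assoc, smul_mul_assoc,
        mul_smul_comm, h2, smul_smul, smul_smul, sub_add_sub_comm, add_sub_assoc, ← add_smul, ← sub_smul]
      have : (s : ℂ) - ((s : ℂ) / (1 + s * q) + s * ((s : ℂ) / (1 + s * q)) * q) = 0 := by
        field_simp; ring
      rw [this, zero_smul, add_zero]
    have h3 : (B * W * B).trace = star v ⬝ᵥ (B * B) *ᵥ v := by
      rw [Matrix.trace_mul_comm, ← mul_assoc, hW, mul_vecMulVec, trace_vecMulVec, dotProduct_comm]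
    rw [hinv, trace_sub, trace_smul, h3]
    have : ((s : ℂ) / (1 + s * q)) = ((s / (1 + s * q) : ℝ) : ℂ) := by push_cast; rfl
    rw [this, Complex.sub_re, smul_eq_mul, Complex.re_ofReal_mul]
    ring

lemma up_shift {k : ℕ} (hk : 0 < k) {P : Matrix (Fin k) (Fin k) ℂ} (hP : P.PosDef)
    {δ : ℝ} (hδ : 0 < δ) :
    ∃ Q, Q = P + (δ : ℂ) • (1 : Matrix (Fin k) (Fin k) ℂ) ∧ Q.PosDef ∧
      0 < (P⁻¹).trace.re - (Q⁻¹).trace.re ∧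
      (Q⁻¹ * Q⁻¹).trace.re ≤ ((P⁻¹).trace.re - (Q⁻¹).trace.re) / δ := by
  obtain ⟨p, hp, h⟩ := spec_shift hP
  have h0 := h 0 (by simpa using hp)
  have h1 := h δ (fun i => by linarith [hp i])
  simp only [Complex.ofReal_zero, zero_smul, add_zero] at h0
  refine ⟨_, rfl, h1.1, ?_, ?_⟩
  · rw [h0.2.1, h1.2.1, sub_pos]
    refine Finset.sum_lt_sum_of_nonempty ⟨⟨0, hk⟩, Finset.mem_univ _⟩ fun i _ => ?_
    exact inv_strictAnti₀ (hp i) (by linarith)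
  · rw [h0.2.1, h1.2.1, h1.2.2, ← Finset.sum_sub_distrib, Finset.sum_div]
    refine Finset.sum_le_sum fun i _ => ?_
    have hpi := hp i
    have : ((p i)⁻¹ - (p i + δ)⁻¹) / δ = (p i)⁻¹ * (p i + δ)⁻¹ := by
      field_simp; ring
    rw [this, sq]
    have h2 : (p i + δ)⁻¹ ≤ (p i)⁻¹ := inv_anti₀ hpi (by linarith)
    exact mul_le_mul_of_nonneg_right h2 (by positivity)

lemma low_shift {k : ℕ} (hk : 0 < k) {S : Matrix (Fin k) (Fin k) ℂ} (hS : S.PosDef)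
    {δ : ℝ} (hδ : 0 < δ) (hδS : δ * (S⁻¹).trace.re < 1) :
    ∃ R, R = S + ((-δ : ℝ) : ℂ) • (1 : Matrix (Fin k) (Fin k) ℂ) ∧ R.PosDef ∧
      0 < (R⁻¹).trace.re - (S⁻¹).trace.re ∧
      ((R⁻¹).trace.re - (S⁻¹).trace.re) * (1 / δ + ((R⁻¹).trace.re - (S⁻¹).trace.re))
        ≤ (R⁻¹ * R⁻¹).trace.re := by
  obtain ⟨p, hp, h⟩ := spec_shift hS
  have h0 := h 0 (by simpa using hp)
  simp only [Complex.ofReal_zero, zero_smul, add_zero] at h0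
  rw [h0.2.1] at hδS
  have hpd : ∀ i, 0 < p i + -δ := by
    intro i
    have h2 : (p i)⁻¹ ≤ ∑ j, (p j)⁻¹ :=
      Finset.single_le_sum (f := fun j => (p j)⁻¹) (fun j _ => (inv_pos.2 (hp j)).le)
        (Finset.mem_univ i)
    have h3 : δ * (p i)⁻¹ < 1 := lt_of_le_of_lt (mul_le_mul_of_nonneg_left h2 hδ.le) hδS
    rw [← div_eq_mul_inv, div_lt_one (hp i)] at h3
    linarith
  have h1 := h (-δ) hpd
  refine ⟨_, rfl, h1.1, ?_, ?_⟩
  · rw [h0.2.1, h1.2.1, sub_pos]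
    refine Finset.sum_lt_sum_of_nonempty ⟨⟨0, hk⟩, Finset.mem_univ _⟩ fun i _ => ?_
    exact inv_strictAnti₀ (hpd i) (by linarith)
  · rw [h0.2.1, h1.2.1, h1.2.2, ← Finset.sum_sub_distrib]
    set x : Fin k → ℝ := fun i => (p i + -δ)⁻¹ with hx
    set y : Fin k → ℝ := fun i => (p i)⁻¹ with hy
    have hx0 : ∀ i, 0 < x i := fun i => inv_pos.2 (hpd i)
    have hy0 : ∀ i, 0 < y i := fun i => inv_pos.2 (hp i)
    have hxy : ∀ i, x i - y i = δ * (x i * y i) := by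
      intro i
      have a1 := (hpd i).ne'
      have a2 := (hp i).ne'
      simp only [hx, hy]
      field_simp
      ring
    have hD : ∑ i, ((p i + -δ)⁻¹ - (p i)⁻¹) = δ * ∑ i, x i * y i := by
      rw [Finset.mul_sum]
      exact Finset.sum_congr rfl fun i _ => hxy i
    have hX : ∑ i, ((p i + -δ)⁻¹) ^ 2 = ∑ i, x i * y i + δ * ∑ i, x i ^ 2 * y i := by
      rw [Finset.mul_sum, ← Finset.sum_add_distrib]
      refine Finset.sum_congr rfl fun i _ => ?_
      change x i ^ 2 = _
      linear_combination (x i) * hxy i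
    have hCS : (∑ i, x i * y i) ^ 2 ≤ (∑ i, x i ^ 2 * y i) * ∑ i, y i := by
      apply Finset.sum_sq_le_sum_mul_sum_of_sq_le_mul
      · intro i _; have := hx0 i; have := hy0 i; positivity
      · intro i _; exact (hy0 i).le
      · intro i _; exact le_of_eq (by ring)
    have hZ : 0 ≤ ∑ i, x i ^ 2 * y i := Finset.sum_nonneg fun i _ => by
      have := hx0 i; have := hy0 i; positivity
    rw [hD, hX]
    have e : δ * (∑ i, x i * y i) * (1 / δ + δ * ∑ i, x i * y i)
      = ∑ i, x i * y i + δ * (δ * (∑ i, x i * y i) ^ 2) := by field_simp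
    rw [e]
    have h5 : δ * (∑ i, x i * y i) ^ 2 ≤ ∑ i, x i ^ 2 * y i := by
      calc _ ≤ δ * ((∑ i, x i ^ 2 * y i) * ∑ i, y i) := mul_le_mul_of_nonneg_left hCS hδ.le
        _ = (∑ i, x i ^ 2 * y i) * (δ * ∑ i, y i) := by ring
        _ ≤ (∑ i, x i ^ 2 * y i) * 1 := mul_le_mul_of_nonneg_left hδS.le hZ
        _ = _ := mul_one _
    have := mul_le_mul_of_nonneg_left h5 hδ.le
    linarith

lemma sum_quad {k : ℕ} {ι : Type} [Fintype ι] (v : ι → Fin k → ℂ)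
    (hv : ∑ i, vecMulVec (v i) (star (v i)) = 1) (M : Matrix (Fin k) (Fin k) ℂ) :
    ∑ i, (star (v i) ⬝ᵥ M *ᵥ (v i)).re = M.trace.re := by
  have : M.trace = ∑ i, (star (v i) ⬝ᵥ M *ᵥ (v i)) := by
    conv_lhs => rw [← mul_one M, ← hv, Finset.mul_sum, trace_sum]
    refine Finset.sum_congr rfl fun i _ => ?_
    rw [mul_vecMulVec, trace_vecMulVec, dotProduct_comm]
  rw [this, Complex.re_sum]

lemma bss_step {k : ℕ} (hk : 0 < k) {ι : Type} [Fintype ι] (v : ι → Fin k → ℂ)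
    (hv : ∑ i, vecMulVec (v i) (star (v i)) = 1) {P S : Matrix (Fin k) (Fin k) ℂ}
    (hP : P.PosDef) (hS : S.PosDef) {δU δL εU εL : ℝ} (hδU : 0 < δU) (hδL : 0 < δL)
    (hPt : (P⁻¹).trace.re ≤ εU) (hSt : (S⁻¹).trace.re ≤ εL) (hL : δL * εL < 1)
    (hUL : 1 / δU + εU < 1 / δL - εL) :
    ∃ (i : ι) (t : ℝ), 0 < t ∧
      (P + (δU : ℂ) • (1 : Matrix (Fin k) (Fin k) ℂ)
        + ((-t : ℝ) : ℂ) • vecMulVec (v i) (star (v i))).PosDef ∧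
      (S + ((-δL : ℝ) : ℂ) • (1 : Matrix (Fin k) (Fin k) ℂ)
        + (t : ℂ) • vecMulVec (v i) (star (v i))).PosDef ∧
      ((P + (δU : ℂ) • (1 : Matrix (Fin k) (Fin k) ℂ)
        + ((-t : ℝ) : ℂ) • vecMulVec (v i) (star (v i)))⁻¹).trace.re ≤ εU ∧
      ((S + ((-δL : ℝ) : ℂ) • (1 : Matrix (Fin k) (Fin k) ℂ)
        + (t : ℂ) • vecMulVec (v i) (star (v i)))⁻¹).trace.re ≤ εL := by
  obtain ⟨Q, hQe, hQ, hDU, hQ2⟩ := up_shift hk hP hδU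
  obtain ⟨R, hRe, hR, hDL, hR2⟩ := low_shift hk hS hδL
    (lt_of_le_of_lt (mul_le_mul_of_nonneg_left hSt hδL.le) hL)
  rw [← hQe, ← hRe]
  set DU := (P⁻¹).trace.re - (Q⁻¹).trace.re with hDUe
  set DL := (R⁻¹).trace.re - (S⁻¹).trace.re with hDLe
  have hnn : ∀ {M : Matrix (Fin k) (Fin k) ℂ}, M.PosDef → ∀ x : Fin k → ℂ,
      0 ≤ (star x ⬝ᵥ M⁻¹ *ᵥ x).re ∧ 0 ≤ (star x ⬝ᵥ (M⁻¹ * M⁻¹) *ᵥ x).re := by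
    intro M hM x
    constructor
    · have := hM.inv.posSemidef.dotProduct_mulVec_nonneg x
      rw [Complex.le_def] at this
      exact this.1
    · have h := Matrix.posSemidef_conjTranspose_mul_self (M⁻¹)
      rw [hM.inv.isHermitian.eq] at h
      have := h.dotProduct_mulVec_nonneg x
      rw [Complex.le_def] at this
      exact this.1
  have hlt : ∑ i, ((star (v i) ⬝ᵥ (Q⁻¹ * Q⁻¹) *ᵥ (v i)).re / DU + (star (v i) ⬝ᵥ Q⁻¹ *ᵥ (v i)).re)
      < ∑ i, ((star (v i) ⬝ᵥ (R⁻¹ * R⁻¹) *ᵥ (v i)).re / DL - (star (v i) ⬝ᵥ R⁻¹ *ᵥ (v i)).re) := by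
    rw [Finset.sum_add_distrib, Finset.sum_sub_distrib, ← Finset.sum_div, ← Finset.sum_div,
      sum_quad v hv, sum_quad v hv, sum_quad v hv, sum_quad v hv]
    have h1 : (Q⁻¹ * Q⁻¹).trace.re / DU ≤ 1 / δU := by
      rw [div_le_iff₀ hDU]
      calc _ ≤ _ := hQ2
        _ = _ := by ring
    have h2 : 1 / δL + DL ≤ (R⁻¹ * R⁻¹).trace.re / DL := by
      rw [le_div_iff₀ hDL, mul_comm]
      exact hR2
    linarith
  obtain ⟨i, -, hi⟩ := Finset.exists_lt_of_sum_lt hlt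
  obtain ⟨hq1, hr1⟩ := hnn hQ (v i)
  obtain ⟨hq2, hr2⟩ := hnn hR (v i)
  set q1 := (star (v i) ⬝ᵥ Q⁻¹ *ᵥ (v i)).re
  set r1 := (star (v i) ⬝ᵥ (Q⁻¹ * Q⁻¹) *ᵥ (v i)).re
  set q2 := (star (v i) ⬝ᵥ R⁻¹ *ᵥ (v i)).re
  set r2 := (star (v i) ⬝ᵥ (R⁻¹ * R⁻¹) *ᵥ (v i)).re
  set g := r2 / DL - q2 with hg
  have hr1D : 0 ≤ r1 / DU := div_nonneg hr1 hDU.le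
  have hg0 : 0 < g := by linarith
  have ht : 0 < g⁻¹ := inv_pos.2 hg0
  have htg : g⁻¹ * g = 1 := inv_mul_cancel₀ hg0.ne'
  have htf : g⁻¹ * (r1 / DU + q1) < 1 := by
    rw [← htg]; exact mul_lt_mul_of_pos_left hi ht
  have hpos1 : 0 < 1 + (-g⁻¹) * q1 := by
    have := mul_nonneg ht.le hr1D
    nlinarith
  have hpos2 : 0 < 1 + g⁻¹ * q2 := by
    have := mul_nonneg ht.le hq2
    linarith
  obtain ⟨a1, a2⟩ := rank_one_update hQ (v i) (-g⁻¹) hpos1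
  obtain ⟨b1, b2⟩ := rank_one_update hR (v i) (g⁻¹) hpos2
  refine ⟨i, g⁻¹, ht, a1, b1, ?_, ?_⟩
  · rw [a2]
    have : g⁻¹ * r1 / (1 + -g⁻¹ * q1) ≤ DU := by
      rw [div_le_iff₀ hpos1]
      have e : r1 = (r1 / DU) * DU := by field_simp
      have := mul_le_mul_of_nonneg_left htf.le hDU.le
      calc g⁻¹ * r1 = DU * (g⁻¹ * (r1 / DU + q1)) - DU * (g⁻¹ * q1) := by
            conv_lhs => rw [e]
            ring
        _ ≤ DU * 1 - DU * (g⁻¹ * q1) := by linarith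
        _ = _ := by ring
    have e2 : -g⁻¹ * r1 / (1 + -g⁻¹ * q1) = -(g⁻¹ * r1 / (1 + -g⁻¹ * q1)) := by ring
    change _ - -g⁻¹ * r1 / (1 + -g⁻¹ * q1) ≤ _
    rw [e2]
    linarith
  · rw [b2]
    have : DL ≤ g⁻¹ * r2 / (1 + g⁻¹ * q2) := by
      rw [le_div_iff₀ hpos2]
      have e : r2 = DL * (g + q2) := by rw [hg]; field_simp; ring
      rw [e]
      apply le_of_eq
      linear_combination (-DL) * htg
    change _ - g⁻¹ * r2 / (1 + g⁻¹ * q2) ≤ _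
    linarith

lemma quad_rank_one {k : ℕ} (v x : Fin k → ℂ) :
    star x ⬝ᵥ vecMulVec v (star v) *ᵥ x = ((Complex.normSq (star v ⬝ᵥ x) : ℝ) : ℂ) := by
  have h1 : star x ⬝ᵥ v = star (star v ⬝ᵥ x) := by
    rw [star_dotProduct]
  rw [vecMulVec_mulVec, dotProduct_smul, h1]
  simp [Complex.normSq_eq_conj_mul_self, mul_comm]

lemma quad_one {k : ℕ} (x : Fin k → ℂ) :
    star x ⬝ᵥ x = ((∑ j, Complex.normSq (x j) : ℝ) : ℂ) := by
  simp [dotProduct, Complex.normSq_eq_conj_mul_self]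

lemma bss_iter {k : ℕ} (hk : 0 < k) {ι : Type} [Fintype ι] (v : ι → Fin k → ℂ)
    (hv : ∑ i, vecMulVec (v i) (star (v i)) = 1) {η : ℝ} (hη : 0 < η) (hη' : η ≤ 1 / 10) (N : ℕ) :
    ∃ s : ι → ℝ, (∀ i, 0 ≤ s i) ∧ (Finset.univ.filter fun i => s i ≠ 0).card ≤ N ∧
      ∃ P S : Matrix (Fin k) (Fin k) ℂ,
      P = ((k / η + N * (1 / (1 - 3 * η)) : ℝ) : ℂ) • (1 : Matrix (Fin k) (Fin k) ℂ)
        - ∑ i, (s i : ℂ) • vecMulVec (v i) (star (v i)) ∧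
      S = ∑ i, (s i : ℂ) • vecMulVec (v i) (star (v i)) -
        ((N - k / η : ℝ) : ℂ) • (1 : Matrix (Fin k) (Fin k) ℂ) ∧
      P.PosDef ∧ S.PosDef ∧ (P⁻¹).trace.re ≤ η ∧ (S⁻¹).trace.re ≤ η := by
  classical
  have hk' : (0 : ℝ) < k := by exact_mod_cast hk
  induction N with
  | zero =>
    have hpos : (((k / η : ℝ) : ℂ) • (1 : Matrix (Fin k) (Fin k) ℂ)).PosDef := by
      rw [smul_one_eq_diagonal, posDef_diagonal_iff]
      intro i
      have : 0 < (k / η : ℝ) := by positivity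
      exact_mod_cast this
    have htr : ((((k / η : ℝ) : ℂ) • (1 : Matrix (Fin k) (Fin k) ℂ))⁻¹).trace.re ≤ η := by
      have : (((k / η : ℝ) : ℂ) • (1 : Matrix (Fin k) (Fin k) ℂ))⁻¹
          = ((η / k : ℝ) : ℂ) • (1 : Matrix (Fin k) (Fin k) ℂ) := by
        apply Matrix.inv_eq_right_inv
        rw [smul_mul_smul_comm, one_mul, ← Complex.ofReal_mul]
        have : (k / η * (η / k) : ℝ) = 1 := by field_simp
        rw [this]; simp
      rw [this, trace_smul, trace_one, smul_eq_mul, Complex.re_ofReal_mul]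
      simp
      field_simp
      exact le_refl _
    refine ⟨0, fun i => le_refl _, by simp, _, _, rfl, rfl, ?_⟩
    have e1 : ((k / η + (0 : ℕ) * (1 / (1 - 3 * η)) : ℝ) : ℂ) • (1 : Matrix (Fin k) (Fin k) ℂ)
        - ∑ i, (((0 : ι → ℝ) i : ℝ) : ℂ) • vecMulVec (v i) (star (v i))
        = ((k / η : ℝ) : ℂ) • (1 : Matrix (Fin k) (Fin k) ℂ) := by simp
    have e2 : ∑ i, (((0 : ι → ℝ) i : ℝ) : ℂ) • vecMulVec (v i) (star (v i)) -
        (((0 : ℕ) - k / η : ℝ) : ℂ) • (1 : Matrix (Fin k) (Fin k) ℂ)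
        = ((k / η : ℝ) : ℂ) • (1 : Matrix (Fin k) (Fin k) ℂ) := by simp
    rw [e1, e2]
    exact ⟨hpos, hpos, htr, htr⟩
  | succ N ih =>
    obtain ⟨s, hs, hcard, P, S, hPe, hSe, hP, hS, hPt, hSt⟩ := ih
    have hd : 0 < 1 - 3 * η := by linarith
    obtain ⟨i, t, ht, h1, h2, h3, h4⟩ := bss_step hk v hv hP hS (δU := 1 / (1 - 3 * η)) (δL := 1)
      (by positivity) one_pos hPt hSt (by linarith) (by rw [one_div_one_div]; linarith)
    have hsum : ∑ j, (((s + Pi.single i t : ι → ℝ) j : ℝ) : ℂ) • vecMulVec (v j) (star (v j))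
        = ∑ j, (s j : ℂ) • vecMulVec (v j) (star (v j))
          + (t : ℂ) • vecMulVec (v i) (star (v i)) := by
      simp only [Pi.add_apply, Complex.ofReal_add, add_smul, Finset.sum_add_distrib]
      congr 1
      rw [Finset.sum_eq_single i]
      · simp
      · intro j _ hj; simp [hj]
      · simp
    refine ⟨s + Pi.single i t, ?_, ?_, _, _, ?_, ?_, h1, h2, h3, h4⟩
    · intro j
      by_cases h : j = i
      · subst h; simp; linarith [hs j]
      · simp [h, hs j]
    · calc _ ≤ (insert i (Finset.univ.filter fun i => s i ≠ 0)).card := by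
            apply Finset.card_le_card
            intro j hj
            by_cases h : j = i
            · simp [h]
            · simpa [h] using hj
        _ ≤ _ := (Finset.card_insert_le _ _).trans (by omega)
    · rw [hsum, hPe]
      push_cast
      module
    · rw [hsum, hSe]
      push_cast
      module

lemma bss_final {k : ℕ} (hk : 0 < k) {ι : Type} [Fintype ι] (v : ι → Fin k → ℂ)
    (hv : ∑ i, vecMulVec (v i) (star (v i)) = 1) {ε : ℝ} (hε : 0 < ε) (hε' : ε < 1) :
    ∃ s : ι → ℝ, (∀ i, 0 ≤ s i) ∧
      ((Finset.univ.filter fun i => s i ≠ 0).card : ℝ) ≤ 101 * k / ε ^ 2 ∧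
      ∀ y : Fin k → ℂ,
        (1 - ε) * ∑ j, Complex.normSq (y j) ≤ ∑ i, s i * Complex.normSq (star (v i) ⬝ᵥ y) ∧
        ∑ i, s i * Complex.normSq (star (v i) ⬝ᵥ y) ≤ (1 + ε) * ∑ j, Complex.normSq (y j) := by
  have hk1 : (1 : ℝ) ≤ k := by exact_mod_cast hk
  obtain ⟨η, hηe⟩ : ∃ η : ℝ, η = ε / 10 := ⟨_, rfl⟩
  have hη : 0 < η := by rw [hηe]; positivity
  have hη' : η ≤ 1 / 10 := by linarith
  set N := ⌈(k / η ^ 2 : ℝ)⌉₊ with hN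
  have hN1 : (k / η ^ 2 : ℝ) ≤ N := Nat.le_ceil _
  have hN2 : (N : ℝ) < k / η ^ 2 + 1 := Nat.ceil_lt_add_one (by positivity)
  have hN0 : (0 : ℝ) < N := lt_of_lt_of_le (by positivity) hN1
  obtain ⟨s, hs, hcard, P, S, hPe, hSe, hP, hS, -, -⟩ := bss_iter hk v hv hη hη' N
  have hkη : (k / η : ℝ) ≤ η * N := by
    calc (k / η : ℝ) = η * (k / η ^ 2) := by field_simp
      _ ≤ _ := mul_le_mul_of_nonneg_left hN1 hη.le
  have hinv : 1 / (1 - 3 * η) ≤ 1 + 6 * η := by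
    rw [div_le_iff₀ (by linarith)]
    nlinarith
  refine ⟨fun i => s i / N, fun i => div_nonneg (hs i) hN0.le, ?_, ?_⟩
  · have : (Finset.univ.filter fun i => s i / (N : ℝ) ≠ 0) = Finset.univ.filter fun i => s i ≠ 0 := by
      ext i
      have := hN0.ne'
      simp only [Finset.mem_filter, Finset.mem_univ, true_and, ne_eq, div_eq_zero_iff, this, or_false]
    rw [this]
    calc ((Finset.univ.filter fun i => s i ≠ 0).card : ℝ) ≤ N := by exact_mod_cast hcard
      _ ≤ k / η ^ 2 + 1 := hN2.le
      _ = 100 * k / ε ^ 2 + 1 := by rw [hηe]; field_simp; ring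
      _ ≤ 100 * k / ε ^ 2 + k / ε ^ 2 := by
          gcongr
          rw [le_div_iff₀ (by positivity)]
          nlinarith
      _ = _ := by ring
  · intro y
    have hWy : star y ⬝ᵥ (∑ i, (s i : ℂ) • vecMulVec (v i) (star (v i))) *ᵥ y
        = ((∑ i, s i * Complex.normSq (star (v i) ⬝ᵥ y) : ℝ) : ℂ) := by
      rw [sum_mulVec, dotProduct_sum, Complex.ofReal_sum]
      refine Finset.sum_congr rfl fun i _ => ?_
      rw [smul_mulVec, dotProduct_smul, quad_rank_one, smul_eq_mul, Complex.ofReal_mul]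
    have hPy := (Complex.le_def.1 (hP.posSemidef.dotProduct_mulVec_nonneg y)).1
    have hSy := (Complex.le_def.1 (hS.posSemidef.dotProduct_mulVec_nonneg y)).1
    rw [hPe, sub_mulVec, dotProduct_sub, hWy, smul_mulVec, one_mulVec, dotProduct_smul, quad_one,
      smul_eq_mul, ← Complex.ofReal_mul, ← Complex.ofReal_sub, Complex.ofReal_re,
      Complex.zero_re] at hPy
    rw [hSe, sub_mulVec, dotProduct_sub, hWy, smul_mulVec, one_mulVec, dotProduct_smul, quad_one,
      smul_eq_mul, ← Complex.ofReal_mul, ← Complex.ofReal_sub, Complex.ofReal_re,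
      Complex.zero_re] at hSy
    have hY : 0 ≤ ∑ j, Complex.normSq (y j) := Finset.sum_nonneg fun j _ => Complex.normSq_nonneg _
    have e : ∑ i, s i / N * Complex.normSq (star (v i) ⬝ᵥ y)
        = (∑ i, s i * Complex.normSq (star (v i) ⬝ᵥ y)) / N := by
      rw [Finset.sum_div]
      exact Finset.sum_congr rfl fun i _ => by ring
    rw [e]
    set Y := ∑ j, Complex.normSq (y j)
    set Z := ∑ i, s i * Complex.normSq (star (v i) ⬝ᵥ y)
    constructor
    · rw [le_div_iff₀ hN0]
      have h1 : (1 - ε) * N ≤ N - k / η := by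
        have : η * N ≤ ε * N := mul_le_mul_of_nonneg_right (by linarith) hN0.le
        linarith
      have := mul_le_mul_of_nonneg_right h1 hY
      linarith
    · rw [div_le_iff₀ hN0]
      have h1 : k / η + N * (1 / (1 - 3 * η)) ≤ (1 + ε) * N := by
        have h2 := mul_le_mul_of_nonneg_left hinv hN0.le
        have h3 : 7 * η * N ≤ ε * N := mul_le_mul_of_nonneg_right (by linarith) hN0.le
        linarith
      have := mul_le_mul_of_nonneg_right h1 hY
      linarith

lemma sparsify_map {σ ι : Type} [Fintype σ] [Fintype ι]
    (T : (σ → ℂ) →ₗ[ℂ] EuclideanSpace ℂ ι) {ε : ℝ} (hε : 0 < ε) (hε' : ε < 1) :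
    ∃ s : ι → ℝ, (∀ i, 0 ≤ s i) ∧
      ((Finset.univ.filter fun i => s i ≠ 0).card : ℝ) ≤ 101 * Fintype.card σ / ε ^ 2 ∧
      ∀ x : σ → ℂ,
        (1 - ε) * ∑ i, Complex.normSq (T x i) ≤ ∑ i, s i * Complex.normSq (T x i) ∧
        ∑ i, s i * Complex.normSq (T x i) ≤ (1 + ε) * ∑ i, Complex.normSq (T x i) := by
  classical
  have hkle : Module.finrank ℂ (LinearMap.range T) ≤ Fintype.card σ := by
    have := LinearMap.finrank_range_le T
    rwa [Module.finrank_fintype_fun_eq_card] at this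
  obtain ⟨k, hk⟩ : ∃ k, k = Module.finrank ℂ (LinearMap.range T) := ⟨_, rfl⟩
  rcases Nat.eq_zero_or_pos k with h0 | hpos
  · have hb : LinearMap.range T = ⊥ := Submodule.finrank_eq_zero.1 (by rw [← hk, h0])
    have hT : ∀ x, T x = 0 := fun x => by
      rw [LinearMap.range_eq_bot.1 hb]; rfl
    refine ⟨0, fun _ => le_refl _, ?_, fun x => by simp [hT]⟩
    simp
    positivity
  · let b : OrthonormalBasis (Fin k) ℂ (LinearMap.range T) :=
      (stdOrthonormalBasis ℂ (LinearMap.range T)).reindex (finCongr hk.symm)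
    let v : ι → Fin k → ℂ := fun i j => star ((b j : EuclideanSpace ℂ ι) i)
    have hv : ∑ i, vecMulVec (v i) (star (v i)) = 1 := by
      ext j l
      rw [Matrix.sum_apply]
      have h1 := (orthonormal_iff_ite.1 b.orthonormal) j l
      rw [Matrix.one_apply, ← h1, Submodule.coe_inner, PiLp.inner_apply]
      refine Finset.sum_congr rfl fun i _ => ?_
      simp [v, vecMulVec_apply, mul_comm]
    obtain ⟨s, hs, hcard, hy⟩ := bss_final hpos v hv hε hε'
    refine ⟨s, hs, hcard.trans ?_, fun x => ?_⟩
    · have : (k : ℝ) ≤ Fintype.card σ := by rw [hk]; exact_mod_cast hkle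
      gcongr
    · let z : LinearMap.range T := ⟨T x, LinearMap.mem_range_self T x⟩
      have h1 := hy (fun j => b.repr z j)
      have e1 : ∀ i, star (v i) ⬝ᵥ (fun j => b.repr z j) = T x i := by
        intro i
        have h2 : (z : EuclideanSpace ℂ ι) = ∑ j, b.repr z j • (b j : EuclideanSpace ℂ ι) := by
          conv_lhs => rw [← b.sum_repr z]
          simp
        have h3 : T x i = (z : EuclideanSpace ℂ ι) i := rfl
        rw [h3, h2]
        simp [v, dotProduct, mul_comm]
      have e2 : ∑ j, Complex.normSq (b.repr z j) = ∑ i, Complex.normSq (T x i) := by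
        have h4 : ‖b.repr z‖ ^ 2 = ‖T x‖ ^ 2 := by
          rw [LinearIsometryEquiv.norm_map]; rfl
        rw [EuclideanSpace.norm_sq_eq, EuclideanSpace.norm_sq_eq] at h4
        simpa [Complex.normSq_eq_norm_sq] using h4
      simp only [e1, e2] at h1
      exact h1

noncomputable def omega3 : ℂ := ⟨-1 / 2, Real.sqrt 3 / 2⟩

/-- The linear form of a literal in homogeneous coordinates. -/
noncomputable def litForm {V : Type} (l : V × Bool) : (Option V → ℂ) →ₗ[ℂ] ℂ :=
  if l.2 then LinearMap.proj (R := ℂ) (φ := fun _ : Option V => ℂ) (some l.1) else LinearMap.proj (R := ℂ) (φ := fun _ : Option V => ℂ) none - LinearMap.proj (R := ℂ) (φ := fun _ : Option V => ℂ) (some l.1)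

def asgVec {V : Type} (A : V → Bool) : Option V → ℂ
  | none => 1
  | some v => if A v then 1 else 0

lemma litForm_asg {V : Type} (A : V → Bool) (l : V × Bool) :
    litForm l (asgVec A) = if litVal A l then 1 else 0 := by
  obtain ⟨v, b⟩ := l
  cases b <;> cases h : A v <;> simp [litForm, asgVec, litVal, h]

lemma normSq_or (a b : Bool) :
    Complex.normSq ((if a then 1 else 0) + omega3 * (if b then 1 else 0))
      = if a || b then 1 else 0 := by
  have h3 : Real.sqrt 3 * Real.sqrt 3 = 3 := Real.mul_self_sqrt (by norm_num)
  cases a <;> cases b <;> simp [omega3, Complex.normSq_apply] <;> nlinarith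

/-- There is a constant `C > 0` such that for every `ε ∈ (0,1)` and
every weighted 2SAT formula `Φ` over `n` boolean variables with nonnegative weights,
there is a reweighted sub-formula with at most `C·n/ε²` clauses whose value on every
truth assignment is within factor `(1 ± ε)` of the value of `Φ`. -/
theorem stmt10 :
    ∃ C : ℝ, 0 < C ∧
      ∀ (V : Type) [Fintype V]
        (Φ : Finset ((V × Bool) × (V × Bool))) (w : (V × Bool) × (V × Bool) → ℝ),
        (∀ c ∈ Φ, 0 ≤ w c) →
        ∀ ε : ℝ, ε ∈ Set.Ioo (0 : ℝ) 1 →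
          ∃ (Φε : Finset ((V × Bool) × (V × Bool))) (wε : (V × Bool) × (V × Bool) → ℝ),
            Φε ⊆ Φ ∧ (∀ c ∈ Φε, 0 ≤ wε c) ∧
            (Φε.card : ℝ) ≤ C * (Fintype.card V) / ε ^ 2 ∧
            ∀ A : V → Bool,
              (1 - ε) * twoSatVal Φ w A ≤ twoSatVal Φε wε A ∧
                twoSatVal Φε wε A ≤ (1 + ε) * twoSatVal Φ w A := by
  refine ⟨202, by norm_num, ?_⟩
  intro V _ Φ w hw ε hε
  classical
  rcases isEmpty_or_nonempty V with hV | hV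
  · have hΦ : Φ = ∅ := by
      apply Finset.eq_empty_of_forall_notMem
      intro c
      exact hV.elim c.1.1
    subst hΦ
    exact ⟨∅, w, by simp, by simp, by simp, fun A => by simp [twoSatVal]⟩
  let T : (Option V → ℂ) →ₗ[ℂ] EuclideanSpace ℂ Φ :=
    (WithLp.linearEquiv 2 ℂ (Φ → ℂ)).symm.toLinearMap ∘ₗ
      LinearMap.pi fun c : Φ => ((Real.sqrt (w c) : ℝ) : ℂ) •
        (litForm c.1.1 + omega3 • litForm c.1.2)
  have hT : ∀ (A : V → Bool) (c : Φ), Complex.normSq (T (asgVec A) c)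
      = if litVal A c.1.1 || litVal A c.1.2 then w c else 0 := by
    intro A c
    have h1 : T (asgVec A) c = ((Real.sqrt (w c) : ℝ) : ℂ) *
        (litForm c.1.1 (asgVec A) + omega3 * litForm c.1.2 (asgVec A)) := by
      simp [T, mul_add]
    rw [h1, litForm_asg, litForm_asg, Complex.normSq_mul, normSq_or, Complex.normSq_ofReal,
      Real.mul_self_sqrt (hw c c.2)]
    split_ifs <;> simp
  obtain ⟨s, hs, hcard, hx⟩ := sparsify_map T hε.1 hε.2
  let wε : (V × Bool) × (V × Bool) → ℝ := fun c => if h : c ∈ Φ then s ⟨c, h⟩ * w c else 0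
  refine ⟨(Finset.univ.filter fun i => s i ≠ 0).map (Function.Embedding.subtype _), wε,
    ?_, ?_, ?_, fun A => ?_⟩
  · intro c hc
    simp at hc
    exact hc.1
  · intro c _
    by_cases h : c ∈ Φ
    · simp only [wε, h, dite_true]
      exact mul_nonneg (hs _) (hw c h)
    · simp [wε, h]
  · rw [Finset.card_map]
    refine hcard.trans ?_
    have h1 : (1 : ℝ) ≤ Fintype.card V := by exact_mod_cast Fintype.card_pos
    have h2 : 0 < ε ^ 2 := pow_pos hε.1 2
    rw [Fintype.card_option]
    push_cast
    gcongr ?_ / _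
    linarith
  · have e1 : twoSatVal Φ w A = ∑ c : Φ, Complex.normSq (T (asgVec A) c) := by
      rw [twoSatVal, ← Finset.sum_coe_sort]
      exact Finset.sum_congr rfl fun c _ => (hT A c).symm
    have e2 : twoSatVal ((Finset.univ.filter fun i => s i ≠ 0).map (Function.Embedding.subtype _))
        wε A = ∑ c : Φ, s c * Complex.normSq (T (asgVec A) c) := by
      rw [twoSatVal, Finset.sum_map, Finset.sum_filter]
      refine Finset.sum_congr rfl fun c _ => ?_
      rw [hT]
      by_cases h : s c = 0
      · simp [h]
      · simp [h, wε]
    rw [e1, e2]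
    exact hx _
end

section
/- There is a constant C > 0 such that for every ε ∈ (0,1) and every weighted 2LIN system over n boolean variables (a finite set of linear equations modulo 2, each of the form x + y = b with b ∈ {0,1} over two variables, with nonnegative weights), there exists a reweighted subset of at most C·n/ε² equations such that for every assignment A of the variables to {0,1}, the total weight of the retained equations satisfied by A lies within the interval [(1−ε)·W(A), (1+ε)·W(A)], where W(A) is the total weight of equations of the original system satisfied by A. -/
/-- The value of an assignment `A` on the weighted 2LIN system with equation set `Eqs`
(the equation `(x, y, b)` stands for `x + y = b (mod 2)`) and weights `w`: the total
weight of the satisfied equations. -/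
def twoLinVal {V : Type} (Eqs : Finset (V × V × Bool)) (w : V × V × Bool → ℝ)
    (A : V → Bool) : ℝ :=
  ∑ e ∈ Eqs, if xor (A e.1) (A e.2.1) == e.2.2 then w e else 0

open Matrix in
/-- Real spectral theorem in the form `H = Q diag(λ) Qᵀ`. -/
theorem bss_spectral {n : Type} [Fintype n] [DecidableEq n] (H : Matrix n n ℝ)
    (hH : H.IsHermitian) :
    ∃ (Q : Matrix n n ℝ) (lam : n → ℝ), Q * Qᵀ = 1 ∧ Qᵀ * Q = 1 ∧
      H = Q * diagonal lam * Qᵀ := by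
  refine ⟨hH.eigenvectorUnitary, hH.eigenvalues, ?_, ?_, ?_⟩
  · have := Unitary.coe_mul_star_self hH.eigenvectorUnitary
    rwa [Unitary.coe_star, star_eq_conjTranspose, conjTranspose_eq_transpose_of_trivial] at this
  · have := Unitary.coe_star_mul_self hH.eigenvectorUnitary
    rwa [star_eq_conjTranspose, conjTranspose_eq_transpose_of_trivial] at this
  · conv_lhs => rw [hH.spectral_theorem]
    rw [Unitary.conjStarAlgAut_apply]
    rfl

open Matrix in
/-- Simultaneous description of all shifts of a symmetric matrix by eigenvalues. -/
theorem bss_eigs {n : Type} [Fintype n] [DecidableEq n] (H : Matrix n n ℝ)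
    (hH : H.IsHermitian) :
    ∃ lam : n → ℝ, ∀ s : ℝ,
      ((H + s • (1 : Matrix n n ℝ)).PosDef ↔ ∀ j, 0 < lam j + s) ∧
      ((∀ j, 0 < lam j + s) →
        (H + s • (1 : Matrix n n ℝ))⁻¹.trace = ∑ j, (lam j + s)⁻¹ ∧
        ((H + s • (1 : Matrix n n ℝ))⁻¹ * (H + s • (1 : Matrix n n ℝ))⁻¹).trace
          = ∑ j, (lam j + s)⁻¹ ^ 2) := by
  obtain ⟨Q, lam, h1, h2, h3⟩ := bss_spectral H hH
  refine ⟨lam, fun s => ?_⟩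
  have e : H + s • (1 : Matrix n n ℝ) = Q * diagonal (fun j => lam j + s) * Qᵀ := by
    have : diagonal (fun j => lam j + s) = diagonal lam + s • (1 : Matrix n n ℝ) := by
      ext i j
      by_cases h : i = j <;> simp [h]
    rw [this, Matrix.mul_add, Matrix.add_mul, ← h3]
    simp [h1]
  have hu : IsUnit Q := ⟨⟨Q, Qᵀ, h1, h2⟩, rfl⟩
  rw [e]
  constructor
  · rw [← posDef_diagonal_iff]
    have := Matrix.IsUnit.posDef_star_right_conjugate_iff (x := diagonal (fun j => lam j + s)) hu
    rwa [star_eq_conjTranspose, conjTranspose_eq_transpose_of_trivial] at this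
  · intro hp
    have hi : (Q * diagonal (fun j => lam j + s) * Qᵀ)⁻¹
        = Q * diagonal (fun j => (lam j + s)⁻¹) * Qᵀ := by
      apply inv_eq_right_inv
      calc _ = Q * (diagonal (fun j => lam j + s) * (Qᵀ * Q) *
            diagonal (fun j => (lam j + s)⁻¹)) * Qᵀ := by simp only [Matrix.mul_assoc]
        _ = 1 := by
          rw [h2, Matrix.mul_one, diagonal_mul_diagonal]
          have : (fun j => (lam j + s) * (lam j + s)⁻¹) = fun _ => (1:ℝ) := by
            funext j; exact mul_inv_cancel₀ (hp j).ne'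
          rw [this, diagonal_one, Matrix.mul_one, h1]
    rw [hi]
    constructor
    · rw [trace_mul_comm, ← Matrix.mul_assoc, h2, Matrix.one_mul, trace_diagonal]
    · have : (Q * diagonal (fun j => (lam j + s)⁻¹) * Qᵀ) *
          (Q * diagonal (fun j => (lam j + s)⁻¹) * Qᵀ)
          = Q * (diagonal (fun j => (lam j + s)⁻¹) * (Qᵀ * Q) *
            diagonal (fun j => (lam j + s)⁻¹)) * Qᵀ := by simp only [Matrix.mul_assoc]
      rw [this, h2, Matrix.mul_one, diagonal_mul_diagonal,
        trace_mul_comm, ← Matrix.mul_assoc, h2, Matrix.one_mul, trace_diagonal]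
      simp [sq]

open Matrix in
/-- Upper barrier shift. -/
theorem bss_upper_shift {n : Type} [Fintype n] [DecidableEq n] [Nonempty n] (H : Matrix n n ℝ)
    (hH : H.PosDef) (d : ℝ) (hd : 0 < d) :
    (H + d • (1 : Matrix n n ℝ)).PosDef ∧
    0 < H⁻¹.trace - (H + d • (1 : Matrix n n ℝ))⁻¹.trace ∧
    d * ((H + d • (1 : Matrix n n ℝ))⁻¹ * (H + d • (1 : Matrix n n ℝ))⁻¹).trace ≤
      H⁻¹.trace - (H + d • (1 : Matrix n n ℝ))⁻¹.trace := by
  obtain ⟨lam, hl⟩ := bss_eigs H hH.1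
  have h0 := hl 0
  simp only [zero_smul, add_zero] at h0
  have hpos := h0.1.1 hH
  have hpos' : ∀ j, 0 < lam j + d := fun j => add_pos (hpos j) hd
  have e0 := (h0.2 hpos).1
  obtain ⟨e1, e2⟩ := (hl d).2 hpos'
  refine ⟨(hl d).1.2 hpos', ?_, ?_⟩
  · rw [e0, e1, sub_pos]
    apply Finset.sum_lt_sum_of_nonempty Finset.univ_nonempty
    intro j _
    exact inv_strictAnti₀ (hpos j) (by linarith)
  · rw [e0, e1, e2, ← Finset.sum_sub_distrib, Finset.mul_sum]
    apply Finset.sum_le_sum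
    intro j _
    have h1 := hpos j
    have h2 := hpos' j
    have : (lam j)⁻¹ - (lam j + d)⁻¹ = d * ((lam j)⁻¹ * (lam j + d)⁻¹) := by
      field_simp; ring
    rw [this, sq]
    have : (lam j + d)⁻¹ ≤ (lam j)⁻¹ := inv_anti₀ h1 (by linarith)
    have : 0 < (lam j + d)⁻¹ := inv_pos.2 h2
    gcongr

open Matrix in
/-- Lower barrier shift. -/
theorem bss_lower_shift {n : Type} [Fintype n] [DecidableEq n] [Nonempty n] (H : Matrix n n ℝ)
    (hH : H.PosDef) (hk : H⁻¹.trace < 1) :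
    (H + (-1 : ℝ) • (1 : Matrix n n ℝ)).PosDef ∧
    0 < (H + (-1 : ℝ) • (1 : Matrix n n ℝ))⁻¹.trace - H⁻¹.trace ∧
    ((H + (-1 : ℝ) • (1 : Matrix n n ℝ))⁻¹.trace - H⁻¹.trace) *
      (1 + ((H + (-1 : ℝ) • (1 : Matrix n n ℝ))⁻¹.trace - H⁻¹.trace)) ≤
      ((H + (-1 : ℝ) • (1 : Matrix n n ℝ))⁻¹ * (H + (-1 : ℝ) • (1 : Matrix n n ℝ))⁻¹).trace := by
  obtain ⟨lam, hl⟩ := bss_eigs H hH.1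
  have h0 := hl 0
  simp only [zero_smul, add_zero] at h0
  have hpos := h0.1.1 hH
  have e0 := (h0.2 hpos).1
  have hpos' : ∀ j, 0 < lam j + (-1) := by
    intro j
    have h1 : (lam j)⁻¹ ≤ ∑ j, (lam j)⁻¹ :=
      Finset.single_le_sum (f := fun j => (lam j)⁻¹) (fun i _ => (inv_pos.2 (hpos i)).le)
        (Finset.mem_univ j)
    have h2 : (lam j)⁻¹ < 1 := by rw [e0] at hk; linarith
    have := (inv_lt_one₀ (hpos j)).1 h2
    linarith
  obtain ⟨e1, e2⟩ := (hl (-1)).2 hpos'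
  have key : ∀ j, (lam j + (-1))⁻¹ - (lam j)⁻¹ = (lam j + (-1))⁻¹ * (lam j)⁻¹ := by
    intro j
    have h1 := (hpos j).ne'
    have h2 := (hpos' j).ne'
    field_simp; ring
  have hD : (H + (-1 : ℝ) • (1 : Matrix n n ℝ))⁻¹.trace - H⁻¹.trace
      = ∑ j, (lam j + (-1))⁻¹ * (lam j)⁻¹ := by
    rw [e0, e1, ← Finset.sum_sub_distrib]
    exact Finset.sum_congr rfl fun j _ => key j
  have ia : ∀ j, 0 < (lam j + (-1))⁻¹ := fun j => inv_pos.2 (hpos' j)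
  have ib : ∀ j, 0 < (lam j)⁻¹ := fun j => inv_pos.2 (hpos j)
  refine ⟨(hl (-1)).1.2 hpos', ?_, ?_⟩
  · rw [hD]
    exact Finset.sum_pos (fun j _ => mul_pos (ia j) (ib j)) Finset.univ_nonempty
  · rw [hD, e2]
    rw [e0] at hk
    have hcs : (∑ j, (lam j + (-1))⁻¹ * (lam j)⁻¹) ^ 2 ≤
        (∑ j, (lam j + (-1))⁻¹ ^ 2 * (lam j)⁻¹) * ∑ j, (lam j)⁻¹ := by
      apply Finset.sum_sq_le_sum_mul_sum_of_sq_le_mul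
      · intro j _; exact (mul_pos (pow_pos (ia j) 2) (ib j)).le
      · intro j _; exact (ib j).le
      · intro j _; apply le_of_eq; ring
    have hn : 0 ≤ ∑ j, (lam j + (-1))⁻¹ ^ 2 * (lam j)⁻¹ :=
      Finset.sum_nonneg fun j _ => (mul_pos (pow_pos (ia j) 2) (ib j)).le
    have hs : ∑ j, (lam j + (-1))⁻¹ ^ 2 =
        ∑ j, (lam j + (-1))⁻¹ * (lam j)⁻¹ + ∑ j, (lam j + (-1))⁻¹ ^ 2 * (lam j)⁻¹ := by
      rw [← Finset.sum_add_distrib]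
      refine Finset.sum_congr rfl fun j _ => ?_
      have := key j
      linear_combination (lam j + (-1))⁻¹ * this
    rw [hs]
    nlinarith

open Matrix in
/-- Sherman-Morrison for the trace of the inverse. -/
theorem bss_sherman {n : Type} [Fintype n] [DecidableEq n] (R : Matrix n n ℝ)
    (hR : R.PosDef) (v : n → ℝ) (t : ℝ) (ht : 1 - t * (v ⬝ᵥ R⁻¹ *ᵥ v) ≠ 0) :
    (R - t • vecMulVec v v)⁻¹.trace = R⁻¹.trace +
      t / (1 - t * (v ⬝ᵥ R⁻¹ *ᵥ v)) * ((R⁻¹ *ᵥ v) ⬝ᵥ (R⁻¹ *ᵥ v)) := by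
  have hRG : R * R⁻¹ = 1 := mul_nonsing_inv R ((isUnit_iff_isUnit_det R).1 hR.isUnit)
  have hsym : R⁻¹ᵀ = R⁻¹ := by
    have := hR.inv.1
    rwa [IsHermitian, conjTranspose_eq_transpose_of_trivial] at this
  have hv : v ᵥ* R⁻¹ = R⁻¹ *ᵥ v := by
    conv_rhs => rw [← hsym, mulVec_transpose]
  set G := R⁻¹ with hG
  set s := v ⬝ᵥ G *ᵥ v with hs
  set k := t / (1 - t * s) with hk
  have hkk : k - t - t * k * s = 0 := by rw [hk]; field_simp; ring
  have : (R - t • vecMulVec v v)⁻¹ = G + k • vecMulVec (G *ᵥ v) (G *ᵥ v) := by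
    apply inv_eq_right_inv
    rw [Matrix.sub_mul, Matrix.mul_add, Matrix.mul_add, hRG, Matrix.mul_smul, mul_vecMulVec,
      mulVec_mulVec, hRG, one_mulVec, Matrix.smul_mul, Matrix.smul_mul, vecMulVec_mul, hv,
      Matrix.mul_smul, vecMulVec_mul_vecMulVec, ← hs, vecMulVec_smul]
    have : (1 + k • vecMulVec v (G *ᵥ v) -
        (t • vecMulVec v (G *ᵥ v) + t • k • s • vecMulVec v (G *ᵥ v)))
        = 1 + (k - t - t * k * s) • vecMulVec v (G *ᵥ v) := by
      module
    rw [this, hkk, zero_smul, add_zero]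
  rw [this, trace_add, trace_smul, trace_vecMulVec, smul_eq_mul]

open Matrix in
theorem bss_posDef_sub {n : Type} [Fintype n] [DecidableEq n] (R : Matrix n n ℝ)
    (hR : R.PosDef) (v : n → ℝ) (t : ℝ) (ht0 : 0 < t) (ht : t * (v ⬝ᵥ R⁻¹ *ᵥ v) < 1) :
    (R - t • vecMulVec v v).PosDef := by
  have hRG : R * R⁻¹ = 1 := mul_nonsing_inv R ((isUnit_iff_isUnit_det R).1 hR.isUnit)
  have hsymR : Rᵀ = R := by
    have := hR.1
    rwa [IsHermitian, conjTranspose_eq_transpose_of_trivial] at this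
  refine PosDef.of_dotProduct_mulVec_pos ?_ ?_
  · rw [IsHermitian, conjTranspose_eq_transpose_of_trivial, transpose_sub, transpose_smul,
      transpose_vecMulVec, hsymR]
  · intro x hx
    have hx1 := hR.dotProduct_mulVec_pos hx
    rw [star_trivial] at hx1 ⊢
    have expand : x ⬝ᵥ (R - t • vecMulVec v v) *ᵥ x = x ⬝ᵥ R *ᵥ x - t * (v ⬝ᵥ x) ^ 2 := by
      rw [sub_mulVec, smul_mulVec, vecMulVec_mulVec, dotProduct_sub, dotProduct_smul]
      simp only [op_smul_eq_smul, dotProduct_smul, smul_eq_mul, dotProduct_comm x v]; ring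
    rw [expand]
    set a := v ⬝ᵥ x with ha
    have hy := hR.posSemidef.dotProduct_mulVec_nonneg (x - (t * a) • (R⁻¹ *ᵥ v))
    rw [star_trivial] at hy
    have e2 : (R⁻¹ *ᵥ v) ⬝ᵥ R *ᵥ x = a := by
      rw [dotProduct_mulVec, ← mulVec_transpose, hsymR, mulVec_mulVec, hRG, one_mulVec]
    have e1 : (x - (t * a) • (R⁻¹ *ᵥ v)) ⬝ᵥ R *ᵥ (x - (t * a) • (R⁻¹ *ᵥ v))
        = x ⬝ᵥ R *ᵥ x - 2 * t * a ^ 2 + t ^ 2 * a ^ 2 * (v ⬝ᵥ R⁻¹ *ᵥ v) := by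
      rw [mulVec_sub, mulVec_smul, mulVec_mulVec, hRG, one_mulVec, sub_dotProduct,
        dotProduct_sub, dotProduct_sub, smul_dotProduct, smul_dotProduct, dotProduct_smul,
        dotProduct_smul, e2, dotProduct_comm x v, ← ha, dotProduct_comm _ v]
      simp only [smul_eq_mul]; ring
    rw [e1] at hy
    by_cases ha0 : a = 0
    · rw [ha0]; simpa using hx1
    · have : 0 < t * a ^ 2 := by positivity
      nlinarith

open Matrix in
theorem bss_sum_quad {n ι : Type} [Fintype n] [DecidableEq n] (S : Finset ι) (v : ι → n → ℝ)
    (hv : ∑ i ∈ S, vecMulVec (v i) (v i) = 1) (X : Matrix n n ℝ) :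
    ∑ i ∈ S, v i ⬝ᵥ X *ᵥ v i = X.trace := by
  conv_rhs => rw [← Matrix.mul_one X, ← hv, Matrix.mul_sum, trace_sum]
  refine Finset.sum_congr rfl fun i _ => ?_
  rw [mul_vecMulVec, trace_vecMulVec, dotProduct_comm]

open Matrix in
theorem bss_sum_sq {n ι : Type} [Fintype n] [DecidableEq n] (S : Finset ι) (v : ι → n → ℝ)
    (hv : ∑ i ∈ S, vecMulVec (v i) (v i) = 1) (X : Matrix n n ℝ) (hX : Xᵀ = X) :
    ∑ i ∈ S, (X *ᵥ v i) ⬝ᵥ (X *ᵥ v i) = (X * X).trace := by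
  rw [← bss_sum_quad S v hv (X * X)]
  refine Finset.sum_congr rfl fun i _ => ?_
  rw [← mulVec_mulVec, dotProduct_mulVec (v i), ← mulVec_transpose, hX]

open Matrix in
/-- One step of the barrier argument. `H = u - A`, `L = A - l`. -/
theorem bss_step_s11 {n ι : Type} [Fintype n] [DecidableEq n] [Nonempty n]
    (S : Finset ι) (v : ι → n → ℝ)
    (hv : ∑ i ∈ S, vecMulVec (v i) (v i) = 1) (κ : ℝ) (hκ1 : κ < 1 / 4)
    (d : ℝ) (hd : 0 < d) (hdκ : d⁻¹ = 1 - 2 * κ)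
    (H L : Matrix n n ℝ) (hH : H.PosDef) (hL : L.PosDef)
    (hHt : H⁻¹.trace ≤ κ) (hLt : L⁻¹.trace ≤ κ) :
    ∃ i ∈ S, ∃ t : ℝ, 0 < t ∧
      (H + d • (1 : Matrix n n ℝ) - t • vecMulVec (v i) (v i)).PosDef ∧
      (L + (-1 : ℝ) • (1 : Matrix n n ℝ) + t • vecMulVec (v i) (v i)).PosDef ∧
      (H + d • (1 : Matrix n n ℝ) - t • vecMulVec (v i) (v i))⁻¹.trace ≤ κ ∧
      (L + (-1 : ℝ) • (1 : Matrix n n ℝ) + t • vecMulVec (v i) (v i))⁻¹.trace ≤ κ := by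
  classical
  obtain ⟨hP, hPd, hPi⟩ := bss_upper_shift H hH d hd
  obtain ⟨hM, hMd, hMi⟩ := bss_lower_shift L hL (by linarith)
  set P := H + d • (1 : Matrix n n ℝ) with hPdef
  set M := L + (-1 : ℝ) • (1 : Matrix n n ℝ) with hMdef
  have hPs : P⁻¹ᵀ = P⁻¹ := by
    have := hP.inv.1
    rwa [IsHermitian, conjTranspose_eq_transpose_of_trivial] at this
  have hMs : M⁻¹ᵀ = M⁻¹ := by
    have := hM.inv.1
    rwa [IsHermitian, conjTranspose_eq_transpose_of_trivial] at this
  set DU := H⁻¹.trace - P⁻¹.trace with hDU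
  set DL := M⁻¹.trace - L⁻¹.trace with hDL
  let fU : ι → ℝ := fun i => ((P⁻¹ *ᵥ v i) ⬝ᵥ (P⁻¹ *ᵥ v i)) / DU + v i ⬝ᵥ P⁻¹ *ᵥ v i
  let fL : ι → ℝ := fun i => ((M⁻¹ *ᵥ v i) ⬝ᵥ (M⁻¹ *ᵥ v i)) / DL - v i ⬝ᵥ M⁻¹ *ᵥ v i
  have sU : ∑ i ∈ S, fU i = (P⁻¹ * P⁻¹).trace / DU + P⁻¹.trace := by
    simp only [fU]
    rw [Finset.sum_add_distrib, ← Finset.sum_div, bss_sum_sq S v hv _ hPs, bss_sum_quad S v hv]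
  have sL : ∑ i ∈ S, fL i = (M⁻¹ * M⁻¹).trace / DL - M⁻¹.trace := by
    simp only [fL]
    rw [Finset.sum_sub_distrib, ← Finset.sum_div, bss_sum_sq S v hv _ hMs, bss_sum_quad S v hv]
  have sUL : ∑ i ∈ S, fU i ≤ ∑ i ∈ S, fL i := by
    rw [sU, sL]
    have h1 : (P⁻¹ * P⁻¹).trace / DU ≤ d⁻¹ := by
      rw [div_le_iff₀ hPd, inv_mul_eq_div, le_div_iff₀ hd]; linarith
    have h2 : 1 + DL ≤ (M⁻¹ * M⁻¹).trace / DL := by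
      rw [le_div_iff₀ hMd]; linarith
    linarith
  have hz : ∀ f : ι → ℝ, (∀ i, v i = 0 → f i = 0) →
      ∑ i ∈ S with v i ≠ 0, f i = ∑ i ∈ S, f i := by
    intro f hf
    rw [Finset.sum_filter]
    refine Finset.sum_congr rfl fun i _ => ?_
    by_cases h : v i = 0
    · simp [h, hf i h]
    · simp [h]
  rw [← hz fU (by intro i hi; simp [fU, hi]), ← hz fL (by intro i hi; simp [fL, hi])] at sUL
  have hne : (S.filter fun i => v i ≠ 0).Nonempty := by
    by_contra hcon
    rw [Finset.not_nonempty_iff_eq_empty, Finset.filter_eq_empty_iff] at hcon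
    have : ∑ i ∈ S, vecMulVec (v i) (v i) = 0 := by
      refine Finset.sum_eq_zero fun i hi => ?_
      have := hcon hi
      rw [not_not] at this
      simp [this]
    rw [hv] at this
    exact one_ne_zero this
  obtain ⟨i, hi, hle⟩ := Finset.exists_le_of_sum_le hne sUL
  rw [Finset.mem_filter] at hi
  obtain ⟨hiS, hi0⟩ := hi
  have hPG : P * P⁻¹ = 1 := mul_nonsing_inv P ((isUnit_iff_isUnit_det P).1 hP.isUnit)
  have hnorm : 0 < (P⁻¹ *ᵥ v i) ⬝ᵥ (P⁻¹ *ᵥ v i) := by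
    have h0 : P⁻¹ *ᵥ v i ≠ 0 := by
      intro h
      apply hi0
      rw [← one_mulVec (v i), ← hPG, ← mulVec_mulVec, h, mulVec_zero]
    have := dotProduct_star_self_pos_iff.2 h0
    rwa [star_trivial] at this
  have hsP : 0 < v i ⬝ᵥ P⁻¹ *ᵥ v i := by
    have := hP.inv.dotProduct_mulVec_pos hi0
    rwa [star_trivial] at this
  have hsM : 0 < v i ⬝ᵥ M⁻¹ *ᵥ v i := by
    have := hM.inv.dotProduct_mulVec_pos hi0
    rwa [star_trivial] at this
  have hfU : 0 < fU i := add_pos (div_pos hnorm hPd) hsP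
  have hfUs : v i ⬝ᵥ P⁻¹ *ᵥ v i < fU i := by
    have := div_pos hnorm hPd
    simp only [fU]; linarith
  have hlt : (fU i)⁻¹ * (v i ⬝ᵥ P⁻¹ *ᵥ v i) < 1 := by
    rw [inv_mul_eq_div, div_lt_one hfU]; exact hfUs
  refine ⟨i, hiS, (fU i)⁻¹, inv_pos.2 hfU, bss_posDef_sub P hP _ _ (inv_pos.2 hfU) hlt, ?_, ?_, ?_⟩
  · refine hM.add_posSemidef (PosSemidef.smul ?_ (inv_pos.2 hfU).le)
    have := posSemidef_vecMulVec_self_star (v i)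
    rwa [star_trivial] at this
  · rw [bss_sherman P hP _ _ (by linarith)]
    have : (fU i)⁻¹ / (1 - (fU i)⁻¹ * (v i ⬝ᵥ P⁻¹ *ᵥ v i)) *
        ((P⁻¹ *ᵥ v i) ⬝ᵥ (P⁻¹ *ᵥ v i)) = DU := by
      have e : (fU i)⁻¹ / (1 - (fU i)⁻¹ * (v i ⬝ᵥ P⁻¹ *ᵥ v i)) =
          (fU i - v i ⬝ᵥ P⁻¹ *ᵥ v i)⁻¹ := by
        have h1 : fU i - v i ⬝ᵥ P⁻¹ *ᵥ v i ≠ 0 := by linarith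
        have h2 : 1 - (fU i)⁻¹ * (v i ⬝ᵥ P⁻¹ *ᵥ v i) ≠ 0 := by linarith
        rw [div_eq_iff h2, inv_mul_eq_div, eq_div_iff h1]
        field_simp
      rw [e]
      simp only [fU, add_sub_cancel_right]
      field_simp
    rw [this]
    linarith
  · have e : M + (fU i)⁻¹ • vecMulVec (v i) (v i) = M - (-(fU i)⁻¹) • vecMulVec (v i) (v i) := by
      module
    have hp : 0 < 1 + (fU i)⁻¹ * (v i ⬝ᵥ M⁻¹ *ᵥ v i) := by
      have := mul_pos (inv_pos.2 hfU) hsM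
      linarith
    rw [e, bss_sherman M hM _ _ (by linarith)]
    set N := (M⁻¹ *ᵥ v i) ⬝ᵥ (M⁻¹ *ᵥ v i) with hN
    set s := v i ⬝ᵥ M⁻¹ *ᵥ v i with hs
    have e2 : -(fU i)⁻¹ / (1 - -(fU i)⁻¹ * s) = - (fU i + s)⁻¹ := by
      have h1 : fU i + s ≠ 0 := by linarith
      have h2 : 1 - -(fU i)⁻¹ * s ≠ 0 := by linarith
      rw [div_eq_iff h2]
      field_simp
      ring
    rw [e2]
    have h3 : fU i + s ≤ N / DL := by
      have : fL i = N / DL - s := rfl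
      linarith
    have h4 : DL ≤ (fU i + s)⁻¹ * N := by
      rw [inv_mul_eq_div, le_div_iff₀ (by linarith)]
      rw [le_div_iff₀ hMd] at h3
      linarith
    linarith

open Matrix in
theorem bss_start {n : Type} [Fintype n] [DecidableEq n] [Nonempty n] (κ : ℝ) (hκ : 0 < κ) :
    (((Fintype.card n : ℝ) / κ) • (1 : Matrix n n ℝ)).PosDef ∧
    (((Fintype.card n : ℝ) / κ) • (1 : Matrix n n ℝ))⁻¹.trace ≤ κ := by
  have hn : (0 : ℝ) < Fintype.card n := by exact_mod_cast Fintype.card_pos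
  have hc : 0 < (Fintype.card n : ℝ) / κ := div_pos hn hκ
  refine ⟨PosDef.smul PosDef.one hc, ?_⟩
  have : (((Fintype.card n : ℝ) / κ) • (1 : Matrix n n ℝ))⁻¹
      = (((Fintype.card n : ℝ) / κ)⁻¹) • (1 : Matrix n n ℝ) := by
    apply inv_eq_right_inv
    rw [Matrix.smul_mul, Matrix.one_mul, smul_smul, mul_inv_cancel₀ hc.ne', one_smul]
  rw [this, trace_smul, trace_one, smul_eq_mul]
  apply le_of_eq
  field_simp

open Matrix in
theorem bss_loop {n ι : Type} [Fintype n] [DecidableEq n] [Nonempty n]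
    (S : Finset ι) (v : ι → n → ℝ)
    (hv : ∑ i ∈ S, vecMulVec (v i) (v i) = 1) (κ : ℝ) (hκ : 0 < κ) (hκ1 : κ < 1 / 4)
    (d : ℝ) (hd : 0 < d) (hdκ : d⁻¹ = 1 - 2 * κ) (q : ℕ) :
    ∃ (T : Finset ι) (s : ι → ℝ), T ⊆ S ∧ T.card ≤ q ∧ (∀ i, 0 ≤ s i) ∧ (∀ i, i ∉ T → s i = 0) ∧
      (((Fintype.card n : ℝ) / κ + q * d) • (1 : Matrix n n ℝ) -
        ∑ i ∈ S, s i • vecMulVec (v i) (v i)).PosDef ∧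
      (((Fintype.card n : ℝ) / κ - q) • (1 : Matrix n n ℝ) +
        ∑ i ∈ S, s i • vecMulVec (v i) (v i)).PosDef ∧
      (((Fintype.card n : ℝ) / κ + q * d) • (1 : Matrix n n ℝ) -
        ∑ i ∈ S, s i • vecMulVec (v i) (v i))⁻¹.trace ≤ κ ∧
      (((Fintype.card n : ℝ) / κ - q) • (1 : Matrix n n ℝ) +
        ∑ i ∈ S, s i • vecMulVec (v i) (v i))⁻¹.trace ≤ κ := by
  classical
  induction q with
  | zero =>
    obtain ⟨h1, h2⟩ := bss_start (n := n) κ hκ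
    refine ⟨∅, fun _ => 0, by simp, by simp, by simp, by simp, ?_⟩
    simp only [zero_smul, Finset.sum_const_zero, Nat.cast_zero, zero_mul, add_zero, sub_zero]
    exact ⟨h1, h1, h2, h2⟩
  | succ q ih =>
    obtain ⟨T, s, hTS, hTc, hs0, hsT, hH, hL, hHt, hLt⟩ := ih
    obtain ⟨i, hi, t, ht, h1, h2, h3, h4⟩ := bss_step_s11 S v hv κ hκ1 d hd hdκ _ _ hH hL hHt hLt
    have hsum : ∑ j ∈ S, (s + Pi.single i t : ι → ℝ) j • vecMulVec (v j) (v j) =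
        ∑ j ∈ S, s j • vecMulVec (v j) (v j) + t • vecMulVec (v i) (v i) := by
      simp only [Pi.add_apply, add_smul, Finset.sum_add_distrib]
      congr 1
      rw [Finset.sum_eq_single i]
      · simp
      · intro j _ hj; simp [hj]
      · intro h; exact absurd hi h
    refine ⟨insert i T, s + Pi.single i t, ?_, ?_, ?_, ?_, ?_⟩
    · exact Finset.insert_subset hi hTS
    · exact (Finset.card_insert_le i T).trans (by omega)
    · intro j
      have : 0 ≤ (Pi.single i t : ι → ℝ) j := by
        by_cases h : j = i
        · subst h; simpa using ht.le
        · simp [h]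
      exact add_nonneg (hs0 j) this
    · intro j hj
      rw [Finset.mem_insert, not_or] at hj
      simp [hj.1, hsT j hj.2]
    · rw [hsum]
      set A := ∑ j ∈ S, s j • vecMulVec (v j) (v j)
      set c := (Fintype.card n : ℝ) / κ
      have e1 : (c + (q + 1 : ℕ) * d) • (1 : Matrix n n ℝ) - (A + t • vecMulVec (v i) (v i))
          = (c + q * d) • (1 : Matrix n n ℝ) - A + d • (1 : Matrix n n ℝ)
            - t • vecMulVec (v i) (v i) := by
        push_cast; module
      have e2 : (c - (q + 1 : ℕ)) • (1 : Matrix n n ℝ) + (A + t • vecMulVec (v i) (v i))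
          = (c - q) • (1 : Matrix n n ℝ) + A + (-1 : ℝ) • (1 : Matrix n n ℝ)
            + t • vecMulVec (v i) (v i) := by
        push_cast; module
      rw [e1, e2]
      exact ⟨h1, h2, h3, h4⟩

open Matrix in
theorem bss_quad_sum {n ι : Type} [Fintype n] [DecidableEq n] (S : Finset ι) (v : ι → n → ℝ)
    (s : ι → ℝ) (x : n → ℝ) :
    x ⬝ᵥ (∑ i ∈ S, s i • vecMulVec (v i) (v i)) *ᵥ x = ∑ i ∈ S, s i * (v i ⬝ᵥ x) ^ 2 := by
  rw [Matrix.sum_mulVec, dotProduct_sum]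
  refine Finset.sum_congr rfl fun i _ => ?_
  rw [smul_mulVec, vecMulVec_mulVec, dotProduct_smul]
  simp only [op_smul_eq_smul, dotProduct_smul, smul_eq_mul, dotProduct_comm x (v i)]; ring

open Matrix in
/-- Batson-Spielman-Srivastava, isotropic form. -/
theorem bss_isotropic {n ι : Type} [Fintype n] [DecidableEq n] [Nonempty n]
    (S : Finset ι) (v : ι → n → ℝ)
    (hv : ∑ i ∈ S, vecMulVec (v i) (v i) = 1) (ε : ℝ) (hε : 0 < ε) (hε1 : ε < 1) :
    ∃ (T : Finset ι) (s : ι → ℝ), T ⊆ S ∧ (T.card : ℝ) ≤ 128 * (Fintype.card n) / ε ^ 2 ∧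
      (∀ i, 0 ≤ s i) ∧ ∀ x : n → ℝ,
        (1 - ε) * (x ⬝ᵥ x) ≤ ∑ i ∈ T, s i * (v i ⬝ᵥ x) ^ 2 ∧
        ∑ i ∈ T, s i * (v i ⬝ᵥ x) ^ 2 ≤ (1 + ε) * (x ⬝ᵥ x) := by
  have hn : (1 : ℝ) ≤ Fintype.card n := by exact_mod_cast Fintype.card_pos
  obtain ⟨κ, hκe⟩ : ∃ κ : ℝ, κ = ε / 8 := ⟨_, rfl⟩
  have hκ : 0 < κ := by rw [hκe]; positivity
  have hκ1 : κ < 1 / 8 := by rw [hκe]; linarith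
  have hd0 : 0 < 1 - 2 * κ := by linarith
  obtain ⟨q, hq⟩ : ∃ q : ℕ, q = ⌈(Fintype.card n : ℝ) / κ ^ 2⌉₊ := ⟨_, rfl⟩
  have hq1 : (Fintype.card n : ℝ) / κ ^ 2 ≤ q := hq ▸ Nat.le_ceil _
  have hq2 : (q : ℝ) < (Fintype.card n : ℝ) / κ ^ 2 + 1 := hq ▸ Nat.ceil_lt_add_one (by positivity)
  have hqpos : (0 : ℝ) < q := lt_of_lt_of_le (by positivity) hq1
  obtain ⟨T, s, hTS, hTc, hs0, hsT, hH, hL, -, -⟩ :=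
    bss_loop S v hv κ hκ (by linarith) (1 - 2 * κ)⁻¹ (inv_pos.2 hd0) (inv_inv _) q
  refine ⟨T, fun i => (q : ℝ)⁻¹ * s i, hTS, ?_, fun i => mul_nonneg (by positivity) (hs0 i), ?_⟩
  · have h1 : (T.card : ℝ) ≤ q := by exact_mod_cast hTc
    have h2 : (1 : ℝ) ≤ (Fintype.card n : ℝ) / κ ^ 2 := by
      rw [le_div_iff₀ (by positivity)]; nlinarith
    have h3 : 128 * (Fintype.card n : ℝ) / ε ^ 2 = 2 * ((Fintype.card n : ℝ) / κ ^ 2) := by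
      rw [hκe]; field_simp; norm_num
    linarith
  · intro x
    have hsum : ∑ i ∈ T, ((q : ℝ)⁻¹ * s i) * (v i ⬝ᵥ x) ^ 2 =
        (q : ℝ)⁻¹ * ∑ i ∈ S, s i * (v i ⬝ᵥ x) ^ 2 := by
      rw [Finset.mul_sum, ← Finset.sum_subset hTS]
      · refine Finset.sum_congr rfl fun i _ => by ring
      · intro i _ hi; simp [hsT i hi]
    rw [hsum]
    have hU := hH.posSemidef.dotProduct_mulVec_nonneg x
    have hLo := hL.posSemidef.dotProduct_mulVec_nonneg x
    rw [star_trivial, sub_mulVec, dotProduct_sub, bss_quad_sum, smul_mulVec, one_mulVec,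
      dotProduct_smul, smul_eq_mul] at hU
    rw [star_trivial, add_mulVec, dotProduct_add, bss_quad_sum, smul_mulVec, one_mulVec,
      dotProduct_smul, smul_eq_mul] at hLo
    have hxx : 0 ≤ x ⬝ᵥ x := by
      have := dotProduct_star_self_nonneg x
      rwa [star_trivial] at this
    set Y := ∑ i ∈ S, s i * (v i ⬝ᵥ x) ^ 2
    set X := x ⬝ᵥ x
    have hc : (Fintype.card n : ℝ) / κ ≤ κ * q := by
      rw [div_le_iff₀ (by positivity)] at hq1 ⊢
      linarith
    have hdle : (1 - 2 * κ)⁻¹ ≤ 1 + 4 * κ := by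
      rw [inv_le_iff_one_le_mul₀ hd0]; nlinarith
    rw [inv_mul_eq_div, le_div_iff₀ hqpos, div_le_iff₀ hqpos]
    have hqX : 0 ≤ q * X := mul_nonneg hqpos.le hxx
    have k1 : (Fintype.card n : ℝ) / κ * X ≤ κ * q * X := mul_le_mul_of_nonneg_right hc hxx
    have k2 : (1 - 2 * κ)⁻¹ * (q * X) ≤ (1 + 4 * κ) * (q * X) :=
      mul_le_mul_of_nonneg_right hdle hqX
    have k3 : 0 ≤ κ * (q * X) := mul_nonneg hκ.le hqX
    have hεκ : ε = 8 * κ := by rw [hκe]; ring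
    rw [hεκ]
    constructor
    · nlinarith
    · nlinarith

open Matrix in
/-- Batson-Spielman-Srivastava for an arbitrary sum of squares of linear forms. -/
theorem bss_general {V ι : Type} [Fintype V] (S : Finset ι) (f : ι → V → ℝ)
    (ε : ℝ) (hε : 0 < ε) (hε1 : ε < 1) :
    ∃ (T : Finset ι) (s : ι → ℝ), T ⊆ S ∧ (T.card : ℝ) ≤ 128 * (Fintype.card V) / ε ^ 2 ∧
      (∀ i, 0 ≤ s i) ∧ ∀ x : V → ℝ,
        (1 - ε) * ∑ i ∈ S, (f i ⬝ᵥ x) ^ 2 ≤ ∑ i ∈ T, s i * (f i ⬝ᵥ x) ^ 2 ∧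
        ∑ i ∈ T, s i * (f i ⬝ᵥ x) ^ 2 ≤ (1 + ε) * ∑ i ∈ S, (f i ⬝ᵥ x) ^ 2 := by
  classical
  obtain ⟨Q, lam, h1, h2, h3⟩ := bss_spectral (∑ i ∈ S, vecMulVec (f i) (f i)) (by
    rw [IsHermitian, conjTranspose_eq_transpose_of_trivial, transpose_sum]
    exact Finset.sum_congr rfl fun i _ => transpose_vecMulVec _ _)
  let g : ι → V → ℝ := fun i => Qᵀ *ᵥ f i
  have hg : ∑ i ∈ S, vecMulVec (g i) (g i) = diagonal lam := by
    have : ∑ i ∈ S, vecMulVec (g i) (g i) = Qᵀ * (∑ i ∈ S, vecMulVec (f i) (f i)) * Q := by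
      rw [Matrix.mul_sum, Matrix.sum_mul]
      refine Finset.sum_congr rfl fun i _ => ?_
      rw [mul_vecMulVec, vecMulVec_mul, ← mulVec_transpose]
    rw [this, h3]
    calc _ = (Qᵀ * Q) * diagonal lam * (Qᵀ * Q) := by simp only [Matrix.mul_assoc]
      _ = _ := by rw [h2, Matrix.one_mul, Matrix.mul_one]
  have hgjk : ∀ j k, ∑ i ∈ S, g i j * g i k = if j = k then lam j else 0 := by
    intro j k
    have := congrFun (congrFun hg j) k
    rw [Matrix.sum_apply] at this
    simpa [vecMulVec_apply, diagonal_apply] using this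
  have hlam : ∀ j, 0 ≤ lam j := by
    intro j
    have := hgjk j j
    rw [if_pos rfl] at this
    rw [← this]
    exact Finset.sum_nonneg fun i _ => mul_self_nonneg _
  have hzero : ∀ j, ¬ 0 < lam j → ∀ i ∈ S, g i j = 0 := by
    intro j hj i hi
    have hj0 : lam j = 0 := le_antisymm (not_lt.1 hj) (hlam j)
    have := hgjk j j
    rw [if_pos rfl, hj0, Finset.sum_eq_zero_iff_of_nonneg fun i _ => mul_self_nonneg _] at this
    exact mul_self_eq_zero.1 (this i hi)
  let J := {j : V // 0 < lam j}
  let r : ι → J → ℝ := fun i j => g i j / √(lam j)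
  have hr : ∑ i ∈ S, vecMulVec (r i) (r i) = 1 := by
    ext j k
    rw [Matrix.sum_apply]
    simp only [vecMulVec_apply, r]
    have : ∀ i, g i j / √(lam j) * (g i k / √(lam k)) =
        g i j * g i k / (√(lam j) * √(lam k)) := fun i => by ring
    simp only [this]
    rw [← Finset.sum_div, hgjk, one_apply]
    by_cases h : j = k
    · subst h
      rw [if_pos rfl, if_pos rfl, Real.mul_self_sqrt (hlam _), div_self j.2.ne']
    · rw [if_neg h, if_neg (fun h' => h (Subtype.ext h')), zero_div]
  let X : (V → ℝ) → J → ℝ := fun x j => √(lam j) * (Qᵀ *ᵥ x) j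
  have hfx : ∀ x, ∀ i ∈ S, f i ⬝ᵥ x = r i ⬝ᵥ X x := by
    intro x i hi
    have e1 : f i ⬝ᵥ x = g i ⬝ᵥ (Qᵀ *ᵥ x) := by
      simp only [g]
      rw [dotProduct_mulVec, ← mulVec_transpose, transpose_transpose, mulVec_mulVec, h1,
        one_mulVec]
    rw [e1]
    simp only [dotProduct]
    rw [← Finset.sum_subset (Finset.subset_univ (Finset.univ.filter fun j => 0 < lam j))]
    · rw [Finset.sum_subtype (p := fun j => 0 < lam j) _ (by simp)]
      refine Finset.sum_congr rfl fun j _ => ?_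
      have : √(lam j) ≠ 0 := (Real.sqrt_pos.2 j.2).ne'
      simp only [r, X]
      field_simp
    · intro j _ hj
      rw [hzero j (by simpa using hj) i hi, zero_mul]
  have hXX : ∀ x, ∑ i ∈ S, (f i ⬝ᵥ x) ^ 2 = X x ⬝ᵥ X x := by
    intro x
    have := bss_quad_sum S r (fun _ => 1) (X x)
    simp only [one_smul, one_mul] at this
    rw [hr, one_mulVec] at this
    rw [this]
    exact Finset.sum_congr rfl fun i hi => by rw [hfx x i hi]
  rcases isEmpty_or_nonempty J with hJ | hJ
  · refine ⟨∅, fun _ => 0, by simp, by simp; positivity, by simp, fun x => ?_⟩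
    rw [hXX]
    simp [dotProduct]
  · obtain ⟨T, s, hT, hc, hs, hx⟩ := bss_isotropic S r hr ε hε hε1
    refine ⟨T, s, hT, hc.trans ?_, hs, fun x => ?_⟩
    · have : (Fintype.card J : ℝ) ≤ Fintype.card V := by
        exact_mod_cast Fintype.card_subtype_le _
      gcongr
    · have e : ∑ i ∈ T, s i * (f i ⬝ᵥ x) ^ 2 = ∑ i ∈ T, s i * (r i ⬝ᵥ X x) ^ 2 :=
        Finset.sum_congr rfl fun i hi => by rw [hfx x i (hT hi)]
      rw [e, hXX]
      exact hx (X x)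

open Matrix in
/-- There is a constant `C > 0` such that for every `ε ∈ (0,1)` and
every weighted 2LIN system over `n` boolean variables (equations `x + y = b (mod 2)`
with nonnegative weights), there is a reweighted subset of at most `C·n/ε²` equations
whose value on every assignment is within factor `(1 ± ε)` of the value of the original
system. -/
theorem stmt11 :
    ∃ C : ℝ, 0 < C ∧
      ∀ (V : Type) [Fintype V]
        (Eqs : Finset (V × V × Bool)) (w : V × V × Bool → ℝ),
        (∀ e ∈ Eqs, 0 ≤ w e) →
        ∀ ε : ℝ, ε ∈ Set.Ioo (0 : ℝ) 1 →
          ∃ (Eqsε : Finset (V × V × Bool)) (wε : V × V × Bool → ℝ),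
            Eqsε ⊆ Eqs ∧ (∀ e ∈ Eqsε, 0 ≤ wε e) ∧
            (Eqsε.card : ℝ) ≤ C * (Fintype.card V) / ε ^ 2 ∧
            ∀ A : V → Bool,
              (1 - ε) * twoLinVal Eqs w A ≤ twoLinVal Eqsε wε A ∧
                twoLinVal Eqsε wε A ≤ (1 + ε) * twoLinVal Eqs w A := by
  classical
  refine ⟨128, by norm_num, ?_⟩
  intro V _ Eqs w hw ε hε
  let f : V × V × Bool → V → ℝ := fun e =>
    (√(w e) / 2) • (Pi.single e.1 1 + (if e.2.2 then (-1 : ℝ) else 1) • Pi.single e.2.1 1)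
  obtain ⟨T, s, hT, hc, hs, hx⟩ := bss_general Eqs f ε hε.1 hε.2
  refine ⟨T, fun e => s e * w e, hT, fun e he => mul_nonneg (hs e) (hw e (hT he)), hc, ?_⟩
  intro A
  have key : ∀ e ∈ Eqs, (f e ⬝ᵥ fun v => if A v then (-1 : ℝ) else 1) ^ 2 =
      if xor (A e.1) (A e.2.1) == e.2.2 then w e else 0 := by
    intro e he
    have hsq := Real.sq_sqrt (hw e he)
    simp only [f, smul_dotProduct, add_dotProduct, single_dotProduct, one_mul, smul_eq_mul]
    rw [mul_pow, div_pow, hsq]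
    rcases A e.1 <;> rcases A e.2.1 <;> rcases e.2.2 <;> norm_num
  have := hx (fun v => if A v then (-1 : ℝ) else 1)
  have e1 : ∑ i ∈ Eqs, (f i ⬝ᵥ fun v => if A v then (-1 : ℝ) else 1) ^ 2 = twoLinVal Eqs w A :=
    Finset.sum_congr rfl key
  have e2 : ∑ i ∈ T, s i * (f i ⬝ᵥ fun v => if A v then (-1 : ℝ) else 1) ^ 2
      = twoLinVal T (fun e => s e * w e) A := by
    refine Finset.sum_congr rfl fun e he => ?_
    rw [key e (hT he), mul_ite, mul_zero]
  rw [e1, e2] at this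
  exact this
end
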